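/- The quaternary form x² + i·y² + z² + i·w² is universal over the Gaussian integers: for every Gaussian integer a there exist Gaussian integers x, y, z, w such that a = x² + i·y² + z² + i·w². -/

import Mathlib

/-- The form `x² + i·y² + z² + i·w²` is universal over the Gaussian integers. -/
theorem stmt_12 (a : GaussianInt) :
    ∃ x y z w : GaussianInt,
      a = x ^ 2 + (⟨0, 1⟩ : GaussianInt) * y ^ 2 + z ^ 2 +
        (⟨0, 1⟩ : GaussianInt) * w ^ 2 := by
  obtain ⟨p, q⟩ := a
  obtain ⟨m, rfl | rfl⟩ := Int.even_or_odd' p <;> obtain ⟨n, rfl | rfl⟩ := Int.even_or_odd' q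
  · -- `x² + z²` represents `2i(1 + (1 + i)e)` with `x = 1 + i + ie`, `z = e`
    obtain ⟨k, hk | hk⟩ := Int.even_or_odd' (m + n)
    · obtain rfl : m = 2 * k - n := by lia
      refine ⟨⟨1 + k, n - k⟩, ⟨1, 1⟩, ⟨n - 1 - k, -k⟩, 0, ?_⟩
      ext <;> simp [pow_two] <;> ring
    · obtain rfl : m = 2 * k + 1 - n := by lia
      refine ⟨⟨1 + k, n - k⟩, 0, ⟨n - 1 - k, -k⟩, 0, ?_⟩
      ext <;> simp [pow_two] <;> ring
  · -- `x² + z²` represents `1 + 2t` with `x = 1 + t`, `z = -it`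
    refine ⟨0, ⟨1 + n, -m⟩, 0, ⟨-m, -n⟩, ?_⟩
    ext <;> simp [pow_two] <;> ring
  · refine ⟨⟨1 + m, n⟩, 0, ⟨n, -m⟩, 0, ?_⟩
    ext <;> simp [pow_two] <;> ring
  · refine ⟨⟨1 + m, n⟩, 1, ⟨n, -m⟩, 0, ?_⟩
    ext <;> simp [pow_two] <;> ring
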